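/- Let d, k be positive integers with k < d+1, set d' = C(d+1, k), and let Λ₁, …, Λ_{d'} enumerate the k-element subsets of {1, …, d+1}. Let f₁, …, f_{d+1} be unit vectors in ℝ^d with ⟨f_i, f_j⟩ = −1/d for all i ≠ j, and define g_i = (Σ_{j∈Λ_i} f_j)/‖Σ_{j∈Λ_i} f_j‖. Then the frame potential of {g_i}, namely Σ_{i=1}^{d'} Σ_{j=1}^{d'} |⟨g_i, g_j⟩|², equals (d')²/d. -/

import Mathlib

open scoped RealInnerProductSpace

namespace Finset

variable {α : Type*} [Fintype α] [DecidableEq α]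

/-- Counting the `k`-subsets that contain a given set `u`, in a form free of divisions. -/
theorem descFactorial_mul_card_filter_powersetCard_subset (u : Finset α) (k : ℕ) :
    (Fintype.card α).descFactorial #u * #{t ∈ powersetCard k univ | u ⊆ t} =
      k.descFactorial #u * (Fintype.card α).choose k := by
  rcases le_or_gt #u k with h | h
  · rw [card_filter_powersetCard_subset u univ k (subset_univ u) h, card_univ,
      Nat.descFactorial_eq_factorial_mul_choose, Nat.descFactorial_eq_factorial_mul_choose,
      mul_assoc, mul_assoc, ← Nat.choose_mul h, mul_comm (k.choose _)]
  · have hempty : ({t ∈ powersetCard k univ | u ⊆ t} : Finset (Finset α)) = ∅ := by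
      refine filter_eq_empty_iff.2 fun t ht hut => ?_
      have := card_le_card hut
      have := (mem_powersetCard.1 ht).2
      omega
    rw [hempty, Nat.descFactorial_eq_zero_iff_lt.2 h, card_empty, mul_zero, zero_mul]

theorem card_mul_sum_card_inter_powersetCard (s : Finset α) (k : ℕ) :
    (Fintype.card α : ℝ) * ∑ t ∈ powersetCard k univ, (#(s ∩ t) : ℝ) =
      #s * (k * (Fintype.card α).choose k) := by
  have hcount : ∀ t : Finset α, (#(s ∩ t) : ℝ) = ∑ a ∈ s, if {a} ⊆ t then 1 else 0 := by
    intro t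
    simp [← filter_mem_eq_inter]
  simp_rw [hcount]
  rw [sum_comm, mul_sum, ← nsmul_eq_mul, ← sum_const]
  refine sum_congr rfl fun a _ => ?_
  have := descFactorial_mul_card_filter_powersetCard_subset {a} k
  rw [card_singleton, Nat.descFactorial_one, Nat.descFactorial_one] at this
  rw [sum_boole]
  exact_mod_cast this

theorem card_mul_sum_card_inter_sq_powersetCard (s : Finset α) (k : ℕ) :
    (Fintype.card α : ℝ) * (Fintype.card α - 1) *
        ∑ t ∈ powersetCard k univ, (#(s ∩ t) : ℝ) ^ 2 =
      #s * k * ((Fintype.card α - 1) + (#s - 1) * (k - 1)) * (Fintype.card α).choose k := by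
  have hdesc : ∀ m : ℕ, (m.descFactorial 2 : ℝ) = m * (m - 1) := by
    intro m
    rcases m with _ | m <;> simp [Nat.descFactorial_succ, mul_comm]
  have hcount : ∀ t : Finset α,
      (#(s ∩ t) : ℝ) ^ 2 = #(s ∩ t) + ∑ p ∈ s.offDiag, if {p.1, p.2} ⊆ t then 1 else 0 := by
    intro t
    have hfilter : {p ∈ s.offDiag | {p.1, p.2} ⊆ t} = (s ∩ t).offDiag := by
      ext p
      simp only [mem_filter, mem_offDiag, insert_subset_iff, singleton_subset_iff, mem_inter]
      tauto
    rw [sum_boole, hfilter, offDiag_card, Nat.cast_sub (Nat.le_mul_self _)]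
    push_cast
    ring
  have hpair : ∀ p ∈ s.offDiag, (Fintype.card α : ℝ) * (Fintype.card α - 1) *
      ∑ t ∈ powersetCard k univ, (if {p.1, p.2} ⊆ t then (1 : ℝ) else 0) =
        k * (k - 1) * (Fintype.card α).choose k := by
    intro p hp
    have := descFactorial_mul_card_filter_powersetCard_subset {p.1, p.2} k
    rw [card_pair (mem_offDiag.1 hp).2.2] at this
    rw [sum_boole, ← hdesc, ← hdesc]
    exact_mod_cast this
  simp_rw [hcount]
  rw [sum_add_distrib, mul_add, mul_right_comm, card_mul_sum_card_inter_powersetCard, sum_comm,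
    mul_sum, sum_congr rfl hpair, sum_const, offDiag_card, nsmul_eq_mul,
    Nat.cast_sub (Nat.le_mul_self _)]
  push_cast
  ring

end Finset

section EquiangularFamily

variable {ι E : Type*} [DecidableEq ι] [NormedAddCommGroup E] [InnerProductSpace ℝ E]

/-- The inner product of two subset sums of an equiangular family of unit vectors. -/
theorem inner_sum_sum_of_equiangular {f : ι → E} {c : ℝ} (hnorm : ∀ i, ‖f i‖ = 1)
    (hangle : ∀ i j, i ≠ j → ⟪f i, f j⟫ = c) (s t : Finset ι) :
    ⟪∑ i ∈ s, f i, ∑ j ∈ t, f j⟫ = (1 - c) * (s ∩ t).card + c * (s.card * t.card) := by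
  have hinner : ∀ i j, ⟪f i, f j⟫ = (1 - c) * (if i = j then 1 else 0) + c := by
    intro i j
    split_ifs with h
    · rw [h, real_inner_self_eq_norm_sq, hnorm]
      ring
    · rw [hangle i j h]
      ring
  simp_rw [sum_inner, inner_sum, hinner, Finset.sum_add_distrib, ← Finset.mul_sum]
  simp
  ring

end EquiangularFamily

/-- If `f₁, …, f_{d+1}` are unit vectors in `ℝ^d` with pairwise inner products `-1/d`, the
frame potential of the family of normalized `k`-subset sums `g_Λ` equals `(d')²/d`, where
`d' = C(d+1,k)`. -/
theorem normalized_subset_sums_frame_potential (d k : ℕ) (hd : 0 < d) (hk : 0 < k)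
    (hkd : k < d + 1)
    (f : Fin (d + 1) → EuclideanSpace ℝ (Fin d))
    (hnorm : ∀ i, ‖f i‖ = 1)
    (hangle : ∀ i j, i ≠ j → ⟪f i, f j⟫ = -1 / (d : ℝ))
    (g : {s : Finset (Fin (d + 1)) // s.card = k} → EuclideanSpace ℝ (Fin d))
    (hg : ∀ s, g s = (‖∑ j ∈ s.1, f j‖)⁻¹ • ∑ j ∈ s.1, f j) :
    ∑ s : {s : Finset (Fin (d + 1)) // s.card = k},
      ∑ t : {s : Finset (Fin (d + 1)) // s.card = k}, |⟪g s, g t⟫| ^ 2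
        = (Nat.choose (d + 1) k : ℝ) ^ 2 / (d : ℝ) := by
  have hd' : (0 : ℝ) < d := by exact_mod_cast hd
  have hk' : (0 : ℝ) < k := by exact_mod_cast hk
  have hdk : (0 : ℝ) < d + 1 - k := by
    have : (k : ℝ) < d + 1 := by exact_mod_cast hkd
    linarith
  have hsum := inner_sum_sum_of_equiangular hnorm hangle
  have hsq : ∀ s t : {s : Finset (Fin (d + 1)) // s.card = k}, |⟪g s, g t⟫| ^ 2 =
      ((d + 1) * ((s.1 ∩ t.1).card : ℝ) - k ^ 2) ^ 2 / (k * (d + 1 - k)) ^ 2 := by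
    intro s t
    have hnormsq : ∀ s : {s : Finset (Fin (d + 1)) // s.card = k},
        ‖∑ j ∈ s.1, f j‖ ^ 2 = k * (d + 1 - k) / d := by
      intro s
      rw [← real_inner_self_eq_norm_sq, hsum, Finset.inter_self, s.2]
      field_simp
      ring
    rw [sq_abs, hg, hg, real_inner_smul_left, real_inner_smul_right, mul_pow, mul_pow, inv_pow,
      inv_pow, hnormsq, hnormsq, hsum, s.2, t.2]
    field_simp
    ring
  have hrow : ∀ s : {s : Finset (Fin (d + 1)) // s.card = k},
      ∑ t : {s : Finset (Fin (d + 1)) // s.card = k}, |⟪g s, g t⟫| ^ 2 =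
        (Nat.choose (d + 1) k : ℝ) / d := by
    intro s
    have hfirst := s.1.card_mul_sum_card_inter_powersetCard k
    have hsecond := s.1.card_mul_sum_card_inter_sq_powersetCard k
    rw [s.2, Fintype.card_fin] at hfirst hsecond
    push_cast at hfirst hsecond
    simp_rw [hsq]
    rw [← Finset.sum_subtype (Finset.powersetCard k Finset.univ) (by simp)
      (fun t => ((d + 1) * ((s.1 ∩ t).card : ℝ) - k ^ 2) ^ 2 / (k * (d + 1 - k)) ^ 2),
      ← Finset.sum_div, div_eq_div_iff (by positivity) hd'.ne']
    have hexpand : ∀ t : Finset (Fin (d + 1)), ((d + 1) * ((s.1 ∩ t).card : ℝ) - k ^ 2) ^ 2 =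
        (d + 1) ^ 2 * ((s.1 ∩ t).card : ℝ) ^ 2 - 2 * (d + 1) * k ^ 2 * (s.1 ∩ t).card + k ^ 4 :=
      fun t => by ring
    simp_rw [hexpand]
    rw [Finset.sum_add_distrib, Finset.sum_sub_distrib, ← Finset.mul_sum, ← Finset.mul_sum,
      Finset.sum_const, Finset.card_powersetCard, Finset.card_univ, Fintype.card_fin,
      nsmul_eq_mul]
    linear_combination (d + 1 : ℝ) * hsecond - 2 * k ^ 2 * d * hfirst
  simp_rw [hrow]
  rw [Finset.sum_const, Finset.card_univ, Fintype.card_finset_len, Fintype.card_fin, nsmul_eq_mul]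
  ring
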